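/- arXiv:2510.23570 — 7 statements merged into one kernel-verified Lean document; each statement's English description precedes it below -/
import Mathlib

section
/- Let n ≥ 2. The additive submonoid 𝒮 of ℤⁿ generated by 𝒜 is saturated: for every x ∈ ℤⁿ, x belongs to 𝒮 if and only if x, regarded as a vector of ℝⁿ, is a finite nonnegative real linear combination of elements of 𝒜. That is, 𝒮 = ℝ≥0𝒜 ∩ ℤⁿ. -/
open scoped NNReal

noncomputable section

/-- `mvec n i j` is the exponent vector `m_{(i+1)(j+1)} = e₁ + ê_{i+1} + ê_{j+1}`
(Lean index `t : Fin n` corresponds to the paper index `t+1`). -/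
def mvec (n : ℕ) [NeZero n] (i j t : Fin n) : ℕ :=
  (if t = 0 then 1 else 0) + (if t = i ∧ i ≠ 0 then 1 else 0) +
    (if t = j ∧ j ≠ 0 then 1 else 0)

/-- The set `𝒜 = {m_{ij} : 1 ≤ i ≤ j ≤ n} ⊆ ℤⁿ`. -/
def Aset (n : ℕ) [NeZero n] : Set (Fin n → ℤ) :=
  {v | ∃ i j : Fin n, i ≤ j ∧ v = fun t => (mvec n i j t : ℤ)}

/-- The set `𝒜` regarded inside `ℝⁿ`. -/
def AsetR (n : ℕ) [NeZero n] : Set (Fin n → ℝ) :=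
  {v | ∃ i j : Fin n, i ≤ j ∧ v = fun t => (mvec n i j t : ℝ)}

lemma mvec_comm (n : ℕ) [NeZero n] (i j : Fin n) : mvec n i j = mvec n j i := by
  funext t
  unfold mvec
  omega

lemma mvec_mem_closure (n : ℕ) [NeZero n] (i j : Fin n) :
    (fun t => (mvec n i j t : ℤ)) ∈ AddSubmonoid.closure (Aset n) := by
  rcases le_total i j with h | h
  · exact AddSubmonoid.subset_closure ⟨i, j, h, rfl⟩
  · exact AddSubmonoid.subset_closure ⟨j, i, h, by rw [mvec_comm]⟩

lemma sum_erase_ite_le (n : ℕ) [NeZero n] (i : Fin n) :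
    ∑ t ∈ Finset.univ.erase 0, (if t = i ∧ i ≠ 0 then 1 else 0) ≤ 1 := by
  by_cases hi : i = 0 <;> simp [hi]

lemma sum_erase_mvec_le (n : ℕ) [NeZero n] (i j : Fin n) :
    ∑ t ∈ Finset.univ.erase 0, mvec n i j t ≤ 2 * mvec n i j 0 := by
  have h0 : 1 ≤ mvec n i j 0 := by simp [mvec, add_assoc]
  have h1 : ∑ t ∈ Finset.univ.erase (0 : Fin n), (if t = 0 then 1 else 0) = 0 :=
    Finset.sum_eq_zero fun t ht => if_neg (Finset.ne_of_mem_erase ht)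
  have hi := sum_erase_ite_le n i
  have hj := sum_erase_ite_le n j
  simp only [mvec, Finset.sum_add_distrib] at *
  omega

/-- A vector that is nonnegative away from the index `0` stays so after subtracting a suitable
`ê i`, and unless its coordinate sum away from `0` vanishes, that sum drops by one. -/
lemma exists_sub_nonneg (n : ℕ) [NeZero n] (z : Fin n → ℤ) (hz : ∀ t, t ≠ 0 → 0 ≤ z t) :
    ∃ i : Fin n, (∀ t, t ≠ 0 → 0 ≤ z t - (if t = i ∧ i ≠ 0 then 1 else 0)) ∧
      ∑ t ∈ Finset.univ.erase 0, (z t - (if t = i ∧ i ≠ 0 then 1 else 0)) ≤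
        max (∑ t ∈ Finset.univ.erase 0, z t - 1) 0 := by
  by_cases h : ∃ i, i ≠ 0 ∧ 0 < z i
  · obtain ⟨i, hi, hzi⟩ := h
    refine ⟨i, fun t ht => ?_, ?_⟩
    · have := hz t ht
      split_ifs with hti
      · rw [hti.1]
        omega
      · omega
    · simp [hi]
  · push Not at h
    refine ⟨0, by simpa using hz, le_max_of_le_right ?_⟩
    simp only [ne_eq, not_true_eq_false, and_false, if_false, sub_zero]
    exact Finset.sum_nonpos fun t ht => h t (Finset.ne_of_mem_erase ht)

lemma mem_closure_Aset_of_le (n : ℕ) [NeZero n] (k : ℕ) (x : Fin n → ℤ) (hk : x 0 = k)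
    (hx : ∀ t, 0 ≤ x t) (hs : ∑ t ∈ Finset.univ.erase 0, x t ≤ 2 * x 0) :
    x ∈ AddSubmonoid.closure (Aset n) := by
  induction k generalizing x with
  | zero =>
    have hsum : ∑ t ∈ Finset.univ.erase 0, x t = 0 :=
      le_antisymm (by simpa [hk] using hs) (Finset.sum_nonneg fun t _ => hx t)
    rw [Finset.sum_eq_zero_iff_of_nonneg fun t _ => hx t] at hsum
    have : x = 0 := by
      funext t
      by_cases ht : t = 0
      · simpa [ht] using hk
      · exact hsum t (by simp [ht])
    rw [this]
    exact zero_mem _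
  | succ k ih =>
    obtain ⟨i, hi, hsi⟩ := exists_sub_nonneg n x fun t _ => hx t
    obtain ⟨j, hj, hsj⟩ := exists_sub_nonneg n _ hi
    set y : Fin n → ℤ := fun t => x t - mvec n i j t with hy
    have hy0 : y 0 = k := by
      have : mvec n i j 0 = 1 := by
        simp +contextual [mvec, eq_comm]
      simp [hy, this, hk]
    have hyt : ∀ t, t ≠ 0 → y t = x t - (if t = i ∧ i ≠ 0 then 1 else 0) -
        (if t = j ∧ j ≠ 0 then 1 else 0) := by
      intro t ht
      simp only [hy, mvec, if_neg ht]
      push_cast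
      ring
    have hxy : x = y + fun t => (mvec n i j t : ℤ) := by
      funext t
      simp [hy]
    rw [hxy]
    refine add_mem (ih y hy0 (fun t => ?_) ?_) (mvec_mem_closure n i j)
    · by_cases ht : t = 0
      · rw [ht, hy0]
        positivity
      · rw [hyt t ht]
        exact hj t ht
    · rw [Finset.sum_congr rfl fun t ht => hyt t (Finset.ne_of_mem_erase ht)]
      push_cast at hk
      omega

lemma nonneg_and_sum_le_of_mem_span (n : ℕ) [NeZero n] (v : Fin n → ℝ)
    (hv : v ∈ Submodule.span ℝ≥0 (AsetR n)) :
    (∀ t, 0 ≤ v t) ∧ ∑ t ∈ Finset.univ.erase 0, v t ≤ 2 * v 0 := by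
  induction hv using Submodule.span_induction with
  | mem v hv =>
    obtain ⟨i, j, -, rfl⟩ := hv
    refine ⟨fun t => by positivity, ?_⟩
    dsimp only
    exact_mod_cast sum_erase_mvec_le n i j
  | zero => simp
  | add v w _ _ hv hw =>
    refine ⟨fun t => add_nonneg (hv.1 t) (hw.1 t), ?_⟩
    simp only [Pi.add_apply, Finset.sum_add_distrib]
    linarith [hv.2, hw.2]
  | smul c v _ hv =>
    refine ⟨fun t => mul_nonneg c.2 (hv.1 t), ?_⟩
    simp only [Pi.smul_apply, NNReal.smul_def, smul_eq_mul, ← Finset.mul_sum]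
    linarith [mul_le_mul_of_nonneg_left hv.2 c.coe_nonneg]

lemma cast_mem_span_of_mem_closure (n : ℕ) [NeZero n] (x : Fin n → ℤ)
    (hx : x ∈ AddSubmonoid.closure (Aset n)) :
    (fun t => (x t : ℝ)) ∈ Submodule.span ℝ≥0 (AsetR n) := by
  induction hx using AddSubmonoid.closure_induction with
  | mem x hx =>
    obtain ⟨i, j, hij, rfl⟩ := hx
    exact Submodule.subset_span ⟨i, j, hij, by simp⟩
  | zero =>
    convert Submodule.zero_mem (Submodule.span ℝ≥0 (AsetR n)) using 1
    funext t
    simp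
  | add x y _ _ hx hy =>
    convert Submodule.add_mem _ hx hy using 1
    funext t
    simp

/-- the submonoid `𝒮 = ℕ𝒜` of `ℤⁿ` is saturated:
`x ∈ 𝒮` iff `x`, viewed in `ℝⁿ`, is a nonnegative real combination of elements of `𝒜`
(i.e. `𝒮 = ℝ≥0𝒜 ∩ ℤⁿ`). -/
theorem Aset_saturated (n : ℕ) [NeZero n] (hn : 2 ≤ n) (x : Fin n → ℤ) :
    x ∈ AddSubmonoid.closure (Aset n) ↔
      (fun t => (x t : ℝ)) ∈ Submodule.span ℝ≥0 (AsetR n) := by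
  refine ⟨cast_mem_span_of_mem_closure n x, fun h => ?_⟩
  obtain ⟨h0, hs⟩ := nonneg_and_sum_le_of_mem_span n _ h
  have hx : ∀ t, 0 ≤ x t := fun t => by exact_mod_cast h0 t
  exact mem_closure_Aset_of_le n (x 0).toNat x (Int.toNat_of_nonneg (hx 0)).symm hx
    (by exact_mod_cast hs)

end
end

section
/- Let n ≥ 2. The convex cone K(𝒮) ⊆ ℝⁿ generated by all N = n(n+1)/2 vectors of 𝒜 equals the convex cone generated by the n vectors e₁, e₁+2e₂, e₁+2e₃, …, e₁+2eₙ. In particular, since these n vectors are linearly independent, K(𝒮) is an n-dimensional simplicial cone. -/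
open scoped NNReal

noncomputable section

/-- The family of ray generators: `rayFam n 0 = e₁` and `rayFam n i = e₁ + 2 e_{i+1}`
for `i ≠ 0` (note `mvec n i i = e₁ + 2 ê_{i+1}`). -/
def rayFam (n : ℕ) [NeZero n] (i : Fin n) : Fin n → ℝ :=
  fun t => (mvec n i i t : ℝ)

theorem mvec_self_zero (n : ℕ) [NeZero n] (i : Fin n) : mvec n i i 0 = 1 := by
  unfold mvec
  grind

theorem mvec_self_of_ne_zero (n : ℕ) [NeZero n] (i : Fin n) {t : Fin n} (ht : t ≠ 0) :
    mvec n i i t = if i = t then 2 else 0 := by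
  unfold mvec
  grind

/-- Each `m_{ij}` is the midpoint of the ray generators `m_{ii}` and `m_{jj}`. -/
theorem mvec_eq_midpoint_rayFam (n : ℕ) [NeZero n] (i j : Fin n) :
    (fun t => (mvec n i j t : ℝ)) =
      (2⁻¹ : ℝ≥0) • rayFam n i + (2⁻¹ : ℝ≥0) • rayFam n j := by
  ext t
  simp only [rayFam, mvec, Pi.add_apply, Pi.smul_apply, NNReal.smul_def, smul_eq_mul,
    NNReal.coe_inv, NNReal.coe_ofNat]
  push_cast
  ring

theorem span_AsetR (n : ℕ) [NeZero n] :
    Submodule.span ℝ≥0 (AsetR n) = Submodule.span ℝ≥0 (Set.range (rayFam n)) := by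
  have mem (i : Fin n) : rayFam n i ∈ Submodule.span ℝ≥0 (Set.range (rayFam n)) :=
    Submodule.subset_span (Set.mem_range_self i)
  apply le_antisymm
  · rw [Submodule.span_le]
    rintro v ⟨i, j, -, rfl⟩
    rw [mvec_eq_midpoint_rayFam]
    exact add_mem (Submodule.smul_mem _ _ (mem i)) (Submodule.smul_mem _ _ (mem j))
  · apply Submodule.span_mono
    rintro v ⟨i, rfl⟩
    exact ⟨i, i, le_rfl, rfl⟩

theorem linearIndependent_rayFam (n : ℕ) [NeZero n] : LinearIndependent ℝ (rayFam n) := by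
  rw [Fintype.linearIndependent_iff]
  intro g hg
  have apply_eq (t : Fin n) : ∑ i, g i * (mvec n i i t : ℝ) = 0 := by
    simpa [rayFam] using congrFun hg t
  have eq_zero (t : Fin n) (ht : t ≠ 0) : g t = 0 := by
    simpa [mvec_self_of_ne_zero n _ ht] using apply_eq t
  have sum_eq : ∑ i, g i = 0 := by simpa [mvec_self_zero] using apply_eq 0
  rw [Fintype.sum_eq_single 0 eq_zero] at sum_eq
  intro i
  by_cases hi : i = 0
  · rw [hi, sum_eq]
  · exact eq_zero i hi

/-- the cone `K(𝒮)` generated by all `N = n(n+1)/2` vectors of `𝒜`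
equals the cone generated by the `n` vectors `e₁, e₁+2e₂, …, e₁+2eₙ`, and these `n`
vectors are linearly independent (so `K(𝒮)` is an `n`-dimensional simplicial cone). -/
theorem cone_eq_simplicial (n : ℕ) [NeZero n] (hn : 2 ≤ n) :
    Submodule.span ℝ≥0 (AsetR n) = Submodule.span ℝ≥0 (Set.range (rayFam n)) ∧
      LinearIndependent ℝ (rayFam n) :=
  ⟨span_AsetR n, linearIndependent_rayFam n⟩

end
end

section
/- Let n ≥ 2 and, for 2 ≤ j ≤ n, let L_j : ℝⁿ → ℝ be the linear functional L_j(x) = 2x₁ − x_j + Σ_{2 ≤ i ≤ n, i ≠ j} x_i. Then L_j(x) ≥ 0 for every x ∈ K(𝒮), and {x ∈ K(𝒮) : L_j(x) = 0} = ℝ≥0·(e₁ + 2e_j). In particular, each ℝ≥0·(e₁+2e_j) is a ray (one-dimensional exposed face) of K(𝒮). -/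
open scoped NNReal

noncomputable section

/-- The vector `e₁ + 2 e_{j+1} ∈ ℝⁿ` (equal to `m_{(j+1)(j+1)}` for `j ≠ 0`). -/
def rayVec (n : ℕ) [NeZero n] (j : Fin n) : Fin n → ℝ := fun t => (mvec n j j t : ℝ)

/-- The linear functional `L_j(x) = 2x₁ − x_j + Σ_{2 ≤ i ≤ n, i ≠ j} x_i`. -/
def Lj (n : ℕ) [NeZero n] (j : Fin n) (x : Fin n → ℝ) : ℝ :=
  2 * x 0 - x j + ∑ t ∈ Finset.univ.filter (fun t => t ≠ (0 : Fin n) ∧ t ≠ j), x t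

theorem Lj_add (n : ℕ) [NeZero n] (j : Fin n) (x y : Fin n → ℝ) :
    Lj n j (x + y) = Lj n j x + Lj n j y := by
  simp only [Lj, Pi.add_apply, Finset.sum_add_distrib]
  ring

theorem Lj_smul (n : ℕ) [NeZero n] (j : Fin n) (c : ℝ) (x : Fin n → ℝ) :
    Lj n j (c • x) = c * Lj n j x := by
  simp only [Lj, Pi.smul_apply, smul_eq_mul, ← Finset.mul_sum]
  ring

theorem Lj_rayVec (n : ℕ) [NeZero n] (j : Fin n) (hj : j ≠ 0) : Lj n j (rayVec n j) = 0 := by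
  have hsum : ∑ t ∈ Finset.univ.filter (fun t => t ≠ (0 : Fin n) ∧ t ≠ j), rayVec n j t = 0 := by
    refine Finset.sum_eq_zero fun t ht => ?_
    obtain ⟨ht0, htj⟩ := (Finset.mem_filter.mp ht).2
    simp [rayVec, mvec, ht0, htj]
  rw [Lj, hsum]
  norm_num [rayVec, mvec, hj, hj.symm]

theorem Lj_mvec_pos (n : ℕ) [NeZero n] (j : Fin n) (hj : j ≠ 0) (a b : Fin n)
    (hab : ¬ (a = j ∧ b = j)) : 0 < Lj n j (fun t => (mvec n a b t : ℝ)) := by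
  have hsum : 0 ≤ ∑ t ∈ Finset.univ.filter (fun t => t ≠ (0 : Fin n) ∧ t ≠ j),
      (mvec n a b t : ℝ) := Finset.sum_nonneg fun t _ => Nat.cast_nonneg _
  have h0 : (1 : ℝ) ≤ mvec n a b 0 := by
    exact_mod_cast (by simp only [mvec, if_true]; omega : 1 ≤ mvec n a b 0)
  have h1 : (mvec n a b j : ℝ) ≤ 1 := by
    have : mvec n a b j ≤ 1 := by
      unfold mvec
      grind
    exact_mod_cast this
  unfold Lj
  linarith

theorem rayVec_mem_span (n : ℕ) [NeZero n] (j : Fin n) :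
    rayVec n j ∈ Submodule.span ℝ≥0 (AsetR n) :=
  Submodule.subset_span ⟨j, j, le_rfl, rfl⟩

theorem Lj_nonneg_and_eq_smul_rayVec (n : ℕ) [NeZero n] (j : Fin n) (hj : j ≠ 0)
    (x : Fin n → ℝ) (hx : x ∈ Submodule.span ℝ≥0 (AsetR n)) :
    0 ≤ Lj n j x ∧ (Lj n j x = 0 → ∃ c : ℝ, 0 ≤ c ∧ x = c • rayVec n j) := by
  induction hx using Submodule.span_induction with
  | mem x hx =>
    obtain ⟨a, b, -, rfl⟩ := hx
    by_cases hab : a = j ∧ b = j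
    · obtain ⟨rfl, rfl⟩ := hab
      exact ⟨(Lj_rayVec n _ hj).ge, fun _ => ⟨1, zero_le_one, (one_smul ℝ _).symm⟩⟩
    · have hpos := Lj_mvec_pos n j hj a b hab
      exact ⟨hpos.le, fun h => absurd h hpos.ne'⟩
  | zero => exact ⟨by simp [Lj], fun _ => ⟨0, le_rfl, (zero_smul ℝ _).symm⟩⟩
  | add x y _ _ hx hy =>
    rw [Lj_add]
    refine ⟨add_nonneg hx.1 hy.1, fun h => ?_⟩
    obtain ⟨hx0, hy0⟩ := (add_eq_zero_iff_of_nonneg hx.1 hy.1).mp h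
    obtain ⟨c, hc, rfl⟩ := hx.2 hx0
    obtain ⟨d, hd, rfl⟩ := hy.2 hy0
    exact ⟨c + d, add_nonneg hc hd, (add_smul c d _).symm⟩
  | smul r x _ hx =>
    rw [NNReal.smul_def, Lj_smul]
    refine ⟨mul_nonneg r.2 hx.1, fun h => ?_⟩
    rcases mul_eq_zero.mp h with hr | hx0
    · exact ⟨0, le_rfl, by rw [hr, zero_smul, zero_smul]⟩
    · obtain ⟨c, hc, rfl⟩ := hx.2 hx0
      exact ⟨r * c, mul_nonneg r.2 hc, smul_smul _ _ _⟩

/-- for `j ≠ 0` (paper index `2 ≤ j+1 ≤ n`), `L_j ≥ 0` on `K(𝒮)` and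
`{x ∈ K(𝒮) : L_j(x) = 0} = ℝ≥0·(e₁ + 2e_j)`; in particular each `ℝ≥0·(e₁+2e_j)` is a
ray (one-dimensional exposed face) of `K(𝒮)`. -/
theorem ray_e1_add_two_ej (n : ℕ) [NeZero n] (hn : 2 ≤ n) (j : Fin n) (hj : j ≠ 0) :
    (∀ x ∈ Submodule.span ℝ≥0 (AsetR n), 0 ≤ Lj n j x) ∧
      {x : Fin n → ℝ | x ∈ Submodule.span ℝ≥0 (AsetR n) ∧ Lj n j x = 0} =
        {y : Fin n → ℝ | ∃ c : ℝ, 0 ≤ c ∧ y = c • rayVec n j} := by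
  refine ⟨fun x hx => (Lj_nonneg_and_eq_smul_rayVec n j hj x hx).1, Set.ext fun x => ⟨?_, ?_⟩⟩
  · rintro ⟨hx, hx0⟩
    exact (Lj_nonneg_and_eq_smul_rayVec n j hj x hx).2 hx0
  · rintro ⟨c, hc, rfl⟩
    exact ⟨Submodule.smul_mem _ (⟨c, hc⟩ : ℝ≥0) (rayVec_mem_span n j),
      by rw [Lj_smul, Lj_rayVec n j hj, mul_zero]⟩

end
end

section
/- Let n ≥ 2 and let J ⊆ {2,…,n} be any nonempty subset. Define the linear functional L_{τ'} : ℝⁿ → ℝ by L_{τ'}(x) = 2x₁ − Σ_{j ∈ J} x_j. Then L_{τ'}(x) ≥ 0 for every x ∈ K(𝒮), and {x ∈ K(𝒮) : L_{τ'}(x) = 0} equals the convex cone generated by {e₁ + 2e_j : j ∈ J}. In particular, this cone is an exposed face of K(𝒮) of dimension |J|. -/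
open scoped NNReal

noncomputable section

theorem mvec_zero (n : ℕ) [NeZero n] (i j : Fin n) : mvec n i j 0 = 1 := by
  have h (k : Fin n) : ¬(0 = k ∧ k ≠ 0) := fun h => h.2 h.1.symm
  simp only [mvec, if_pos, if_neg (h _)]

theorem mvec_of_ne_zero (n : ℕ) [NeZero n] (i j : Fin n) {t : Fin n} (ht : t ≠ 0) :
    mvec n i j t = (if t = i then 1 else 0) + (if t = j then 1 else 0) := by
  have h (k : Fin n) : (t = k ∧ k ≠ 0) ↔ t = k := ⟨And.left, fun h => ⟨h, h ▸ ht⟩⟩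
  simp only [mvec, if_neg ht, h, zero_add]

theorem sum_mvec (n : ℕ) [NeZero n] {J : Finset (Fin n)} (hJ : (0 : Fin n) ∉ J) (i j : Fin n) :
    ∑ t ∈ J, (mvec n i j t : ℝ) = (if i ∈ J then 1 else 0) + (if j ∈ J then 1 else 0) := by
  have h : ∀ t ∈ J, (mvec n i j t : ℝ) = (if t = i then 1 else 0) + (if t = j then 1 else 0) := by
    intro t ht
    rw [mvec_of_ne_zero n i j (ne_of_mem_of_not_mem ht hJ)]
    push_cast
    rfl
  rw [Finset.sum_congr rfl h, Finset.sum_add_distrib, Finset.sum_ite_eq', Finset.sum_ite_eq']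

theorem mvec_eq_smul_rayVec_add (n : ℕ) [NeZero n] (i j : Fin n) :
    (fun t => (mvec n i j t : ℝ)) = (1 / 2 : ℝ≥0) • (rayVec n i + rayVec n j) := by
  ext t
  simp only [Pi.smul_apply, Pi.add_apply, rayVec, mvec, NNReal.smul_def, smul_eq_mul]
  push_cast
  ring

theorem rayVec_mem_AsetR (n : ℕ) [NeZero n] (j : Fin n) : rayVec n j ∈ AsetR n :=
  ⟨j, j, le_rfl, rfl⟩

/-- The functional `x ↦ 2x₁ − Σ_{j ∈ J} x_j`. -/
def faceFunctional (n : ℕ) [NeZero n] (J : Finset (Fin n)) : (Fin n → ℝ) →ₗ[ℝ] ℝ :=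
  (2 : ℝ) • LinearMap.proj 0 - ∑ j ∈ J, LinearMap.proj j

theorem faceFunctional_apply (n : ℕ) [NeZero n] (J : Finset (Fin n)) (x : Fin n → ℝ) :
    faceFunctional n J x = 2 * x 0 - ∑ j ∈ J, x j := by
  simp [faceFunctional]

theorem faceFunctional_mvec (n : ℕ) [NeZero n] {J : Finset (Fin n)} (hJ : (0 : Fin n) ∉ J)
    (i j : Fin n) : faceFunctional n J (fun t => (mvec n i j t : ℝ)) =
      2 - ((if i ∈ J then 1 else 0) + (if j ∈ J then 1 else 0)) := by
  rw [faceFunctional_apply, sum_mvec n hJ, mvec_zero]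
  norm_num

theorem faceFunctional_nonneg_and_mem_span (n : ℕ) [NeZero n] {J : Finset (Fin n)}
    (hJ : (0 : Fin n) ∉ J) {x : Fin n → ℝ} (hx : x ∈ Submodule.span ℝ≥0 (AsetR n)) :
    0 ≤ faceFunctional n J x ∧
      (faceFunctional n J x = 0 → x ∈ Submodule.span ℝ≥0 (rayVec n '' ↑J)) := by
  induction hx using Submodule.span_induction with
  | mem x hx =>
    obtain ⟨i, j, -, rfl⟩ := hx
    rw [faceFunctional_mvec n hJ]
    refine ⟨by split_ifs <;> norm_num, fun h => ?_⟩
    have hij : i ∈ J ∧ j ∈ J := by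
      by_contra hc
      split_ifs at h <;> first | tauto | norm_num at h
    rw [mvec_eq_smul_rayVec_add]
    exact Submodule.smul_mem _ _ (Submodule.add_mem _
      (Submodule.subset_span ⟨i, hij.1, rfl⟩) (Submodule.subset_span ⟨j, hij.2, rfl⟩))
  | zero => simp
  | add x y _ _ ihx ihy =>
    rw [map_add]
    refine ⟨add_nonneg ihx.1 ihy.1, fun h => ?_⟩
    obtain ⟨h₁, h₂⟩ := (add_eq_zero_iff_of_nonneg ihx.1 ihy.1).1 h
    exact Submodule.add_mem _ (ihx.2 h₁) (ihy.2 h₂)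
  | smul c x _ ih =>
    rw [NNReal.smul_def, map_smul, smul_eq_mul]
    refine ⟨mul_nonneg c.2 ih.1, fun h => ?_⟩
    rcases mul_eq_zero.1 h with h | h
    · simp [h]
    · exact Submodule.smul_mem _ c (ih.2 h)

theorem faceFunctional_eq_zero_of_mem_span (n : ℕ) [NeZero n] {J : Finset (Fin n)}
    (hJ : (0 : Fin n) ∉ J) {x : Fin n → ℝ} (hx : x ∈ Submodule.span ℝ≥0 (rayVec n '' ↑J)) :
    faceFunctional n J x = 0 := by
  induction hx using Submodule.span_induction with
  | mem x hx =>
    obtain ⟨j, hj, rfl⟩ := hx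
    have hj : j ∈ J := hj
    unfold rayVec
    rw [faceFunctional_mvec n hJ, if_pos hj]
    norm_num
  | zero => simp
  | add x y _ _ ihx ihy => rw [map_add, ihx, ihy, add_zero]
  | smul c x _ ih => rw [NNReal.smul_def, map_smul, ih, smul_zero]

theorem linearIndependent_rayVec (n : ℕ) [NeZero n] {J : Finset (Fin n)}
    (hJ : (0 : Fin n) ∉ J) : LinearIndependent ℝ (fun j : J => rayVec n j) := by
  rw [Fintype.linearIndependent_iff]
  intro g hg i
  have h := congrFun hg i
  have hi : (i : Fin n) ≠ 0 := ne_of_mem_of_not_mem i.2 hJ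
  simp only [Finset.sum_apply, Pi.smul_apply, rayVec, mvec_of_ne_zero n _ _ hi, smul_eq_mul,
    Pi.zero_apply] at h
  rw [Finset.sum_eq_single i] at h
  · simpa using h
  · intro b _ hb
    simp [Subtype.coe_injective.ne hb.symm]
  · simp

/-- for any nonempty subset `J ⊆ {2,…,n}` (encoded as `J : Finset (Fin n)`
with `0 ∉ J`), the linear functional `L_{τ'}(x) = 2x₁ − Σ_{j ∈ J} x_j` is nonnegative
on `K(𝒮)`, its zero locus in `K(𝒮)` is the cone generated by `{e₁ + 2e_j : j ∈ J}`, and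
this exposed face has dimension `|J|`. -/
theorem exposed_face_without_e1 (n : ℕ) [NeZero n] (hn : 2 ≤ n)
    (J : Finset (Fin n)) (hJne : J.Nonempty) (hJ : (0 : Fin n) ∉ J) :
    (∀ x ∈ Submodule.span ℝ≥0 (AsetR n), 0 ≤ 2 * x 0 - ∑ j ∈ J, x j) ∧
      {x : Fin n → ℝ | x ∈ Submodule.span ℝ≥0 (AsetR n) ∧ 2 * x 0 - ∑ j ∈ J, x j = 0} =
        ↑(Submodule.span ℝ≥0 (rayVec n '' ↑J)) ∧
      Module.finrank ℝ ↥(Submodule.span ℝ (rayVec n '' ↑J)) = J.card := by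
  simp only [← faceFunctional_apply]
  refine ⟨fun x hx => (faceFunctional_nonneg_and_mem_span n hJ hx).1, ?_, ?_⟩
  · ext x
    refine ⟨fun h => (faceFunctional_nonneg_and_mem_span n hJ h.1).2 h.2, fun h =>
      ⟨Submodule.span_mono ?_ h, faceFunctional_eq_zero_of_mem_span n hJ h⟩⟩
    rintro _ ⟨j, -, rfl⟩
    exact rayVec_mem_AsetR n j
  · have h := finrank_span_eq_card (linearIndependent_rayVec n hJ)
    rw [Fintype.card_coe] at h
    rw [Set.image_eq_range]
    exact h

end
end

section
/- Let n ≥ 2 and let 0 ≤ k ≤ n. The number of nonempty subsets F ⊆ ℝⁿ such that F is an exposed face of K(𝒮) (i.e., there exists a linear functional ℓ on ℝⁿ with F = {x ∈ K(𝒮) : ℓ(y) ≤ ℓ(x) for all y ∈ K(𝒮)}) and the ℝ-linear span of F has dimension k, is exactly the binomial coefficient C(n,k). -/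
open scoped NNReal

noncomputable section

/-- The cone `K(𝒮)`: all finite nonnegative real combinations of elements of `𝒜`. -/
def coneK (n : ℕ) [NeZero n] : Set (Fin n → ℝ) :=
  ↑(Submodule.span ℝ≥0 (AsetR n))

/-- The face of a simplicial cone (given by a basis `b`) spanned by the basis vectors in `S`. -/
def simplicialFace {ι E : Type*} [AddCommGroup E] [Module ℝ E]
    (b : Module.Basis ι ℝ E) (S : Finset ι) : Set E :=
  {x | (∀ i, 0 ≤ b.repr x i) ∧ ∀ i, i ∉ S → b.repr x i = 0}

section SimplicialCone

variable {ι E : Type*} [AddCommGroup E] [Module ℝ E] (b : Module.Basis ι ℝ E)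

theorem basis_mem_simplicialFace_iff (S : Finset ι) (i : ι) :
    b i ∈ simplicialFace b S ↔ i ∈ S := by
  classical
  constructor
  · intro h
    by_contra hi
    simpa using h.2 i hi
  · intro hi
    refine ⟨fun j => ?_, fun j hj => ?_⟩
    · rw [b.repr_self, Finsupp.single_apply]
      split_ifs <;> norm_num
    · rw [b.repr_self, Finsupp.single_apply, if_neg]
      rintro rfl
      exact hj hi

theorem simplicialFace_injective : Function.Injective (simplicialFace b) := by
  intro S T h
  ext i
  rw [← basis_mem_simplicialFace_iff b, h, basis_mem_simplicialFace_iff]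

theorem span_simplicialFace (S : Finset ι) :
    Submodule.span ℝ (simplicialFace b S) = Submodule.span ℝ (b '' S) := by
  apply le_antisymm
  · rw [Submodule.span_le]
    intro x hx
    rw [SetLike.mem_coe, b.mem_span_image]
    intro i hi
    by_contra hiS
    exact Finsupp.mem_support_iff.1 hi (hx.2 i hiS)
  · apply Submodule.span_mono
    rintro _ ⟨i, hi, rfl⟩
    exact (basis_mem_simplicialFace_iff b S i).2 hi

theorem finrank_span_simplicialFace (S : Finset ι) :
    Module.finrank ℝ (Submodule.span ℝ (simplicialFace b S)) = S.card := by
  classical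
  rw [span_simplicialFace, ← Finset.coe_image, finrank_span_finset_eq_card,
    Finset.card_image_of_injective _ b.injective]
  rw [Finset.coe_image]
  exact b.linearIndependent.linearIndepOn_id.mono (Set.image_subset_range _ _)

variable [Fintype ι] {K : Set E}

theorem exposed_eq_simplicialFace (hK : ∀ x, x ∈ K ↔ ∀ i, 0 ≤ b.repr x i)
    (ℓ : E →ₗ[ℝ] ℝ) (hℓ : ∀ i, ℓ (b i) ≤ 0) :
    {x ∈ K | ∀ y ∈ K, ℓ y ≤ ℓ x} = simplicialFace b {i | ℓ (b i) = 0} := by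
  have expand (x : E) : ℓ x = ∑ i, b.repr x i * ℓ (b i) := by
    conv_lhs => rw [← b.sum_repr x]
    simp only [map_sum, map_smul, smul_eq_mul]
  have nonpos (x : E) (hx : x ∈ K) : ∀ i ∈ Finset.univ, b.repr x i * ℓ (b i) ≤ 0 :=
    fun i _ => mul_nonpos_of_nonneg_of_nonpos ((hK x).1 hx i) (hℓ i)
  ext x
  constructor
  · rintro ⟨hx, hmax⟩
    have h0 : ℓ x = 0 := le_antisymm (expand x ▸ Finset.sum_nonpos (nonpos x hx))
      (by simpa using hmax 0 ((hK 0).2 (by simp)))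
    rw [expand, Finset.sum_eq_zero_iff_of_nonpos (nonpos x hx)] at h0
    refine ⟨(hK x).1 hx, fun i hi => ?_⟩
    exact (mul_eq_zero.1 (h0 i (Finset.mem_univ i))).resolve_right (by simpa using hi)
  · rintro ⟨hx, hS⟩
    refine ⟨(hK x).2 hx, fun y hy => ?_⟩
    have h0 : ℓ x = 0 := by
      rw [expand]
      refine Finset.sum_eq_zero fun i _ => ?_
      by_cases hi : ℓ (b i) = 0
      · simp [hi]
      · simp [hS i (by simpa using hi)]
    rw [h0, expand]
    exact Finset.sum_nonpos (nonpos y hy)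

theorem nonempty_exposed_iff (hK : ∀ x, x ∈ K ↔ ∀ i, 0 ≤ b.repr x i)
    (F : Set E) :
    (F.Nonempty ∧ ∃ ℓ : E →ₗ[ℝ] ℝ, F = {x ∈ K | ∀ y ∈ K, ℓ y ≤ ℓ x}) ↔
      ∃ S : Finset ι, simplicialFace b S = F := by
  classical
  constructor
  · rintro ⟨⟨x, hx⟩, ℓ, rfl⟩
    refine ⟨_, (exposed_eq_simplicialFace b hK ℓ fun i => ?_).symm⟩
    have hmem : x + b i ∈ K := by
      rw [hK]
      intro j
      have h1 := (hK x).1 hx.1 j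
      rw [map_add, b.repr_self, Finsupp.add_apply, Finsupp.single_apply]
      split_ifs <;> linarith
    simpa using hx.2 _ hmem
  · rintro ⟨S, rfl⟩
    refine ⟨⟨0, by simp [simplicialFace]⟩, -∑ i ∈ Sᶜ, b.coord i, ?_⟩
    have val (i : ι) : (-∑ j ∈ Sᶜ, b.coord j) (b i) = if i ∈ S then 0 else -1 := by
      simp [Finsupp.single_apply]
      split_ifs <;> simp
    rw [exposed_eq_simplicialFace b hK]
    · congr 1
      ext i
      simp [val]
    · intro i
      rw [val]
      split_ifs <;> norm_num

theorem ncard_exposed_faces_finrank (hK : ∀ x, x ∈ K ↔ ∀ i, 0 ≤ b.repr x i)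
    (k : ℕ) :
    {F : Set E | F.Nonempty ∧
        (∃ ℓ : E →ₗ[ℝ] ℝ, F = {x ∈ K | ∀ y ∈ K, ℓ y ≤ ℓ x}) ∧
        Module.finrank ℝ ↥(Submodule.span ℝ F) = k}.ncard = (Fintype.card ι).choose k := by
  have key : {F : Set E | F.Nonempty ∧
        (∃ ℓ : E →ₗ[ℝ] ℝ, F = {x ∈ K | ∀ y ∈ K, ℓ y ≤ ℓ x}) ∧
        Module.finrank ℝ ↥(Submodule.span ℝ F) = k} =
      simplicialFace b '' (Finset.powersetCard k (Finset.univ : Finset ι) : Set (Finset ι)) := by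
    ext F
    rw [Set.mem_ofPred_eq, ← and_assoc, nonempty_exposed_iff b hK]
    constructor
    · rintro ⟨⟨S, rfl⟩, h⟩
      rw [finrank_span_simplicialFace] at h
      exact ⟨S, by simp [h], rfl⟩
    · rintro ⟨S, h, rfl⟩
      refine ⟨⟨S, rfl⟩, ?_⟩
      rw [finrank_span_simplicialFace]
      simpa using h
  rw [key, Set.ncard_image_of_injective _ (simplicialFace_injective b), Set.ncard_coe_finset,
    Finset.card_powersetCard, Finset.card_univ]

end SimplicialCone

/-- Coordinates with respect to the vectors `m_{ii}`, which generate the extreme rays of `K(𝒮)`. -/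
def rayCoords (n : ℕ) [NeZero n] : (Fin n → ℝ) ≃ₗ[ℝ] (Fin n → ℝ) where
  toFun x i := if i = 0 then x 0 - (∑ j ∈ Finset.univ.erase 0, x j) / 2 else x i / 2
  invFun c i := if i = 0 then ∑ j, c j else 2 * c i
  map_add' x y := by
    funext i
    by_cases hi : i = 0
    · simp only [hi, if_true, Pi.add_apply, Finset.sum_add_distrib]
      ring
    · simp only [hi, if_false, Pi.add_apply]
      ring
  map_smul' r x := by
    funext i
    by_cases hi : i = 0
    · simp only [hi, if_true, Pi.smul_apply, smul_eq_mul, ← Finset.mul_sum, RingHom.id_apply]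
      ring
    · simp only [hi, if_false, Pi.smul_apply, smul_eq_mul, RingHom.id_apply]
      ring
  left_inv x := by
    funext i
    by_cases hi : i = 0
    · subst hi
      simp only [if_true]
      rw [← Finset.add_sum_erase _ _ (Finset.mem_univ (0 : Fin n)), if_pos rfl,
        Finset.sum_congr rfl fun j hj => if_neg (Finset.ne_of_mem_erase hj), ← Finset.sum_div]
      ring
    · simp only [hi, if_false]
      ring
  right_inv c := by
    funext i
    by_cases hi : i = 0
    · subst hi
      simp only [if_true]
      rw [← Finset.add_sum_erase _ _ (Finset.mem_univ (0 : Fin n)),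
        Finset.sum_congr rfl fun j hj => if_neg (Finset.ne_of_mem_erase hj), ← Finset.mul_sum]
      ring
    · simp only [hi, if_false]
      ring

theorem rayCoords_symm_single (n : ℕ) [NeZero n] (i : Fin n) :
    (rayCoords n).symm (Pi.single i 1) = fun t => (mvec n i i t : ℝ) := by
  funext t
  change (if t = 0 then ∑ j, (Pi.single i 1 : Fin n → ℝ) j
    else 2 * (Pi.single i 1 : Fin n → ℝ) t) = _
  by_cases ht : t = 0
  · subst ht
    by_cases hi : 0 = i <;> simp [mvec, hi]
  · by_cases hti : t = i
    · subst hti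
      simp [mvec, ht]
    · simp [mvec, ht, hti]

theorem mvec_eq_midpoint (n : ℕ) [NeZero n] (i j : Fin n) :
    (fun t => (mvec n i j t : ℝ)) =
      (1 / 2 : ℝ) • ((fun t => (mvec n i i t : ℝ)) + fun t => (mvec n j j t : ℝ)) := by
  funext t
  simp only [mvec, Pi.smul_apply, Pi.add_apply, smul_eq_mul]
  push_cast
  ring

theorem mem_coneK_iff (n : ℕ) [NeZero n] (x : Fin n → ℝ) :
    x ∈ coneK n ↔ ∀ i, 0 ≤ rayCoords n x i := by
  constructor
  · intro hx
    induction hx using Submodule.span_induction with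
    | mem x hx =>
      obtain ⟨i, j, -, rfl⟩ := hx
      intro t
      rw [mvec_eq_midpoint, ← rayCoords_symm_single, ← rayCoords_symm_single, ← map_add,
        ← map_smul, LinearEquiv.apply_symm_apply]
      have h (l : Fin n) : 0 ≤ (Pi.single l 1 : Fin n → ℝ) t := by
        rw [Pi.single_apply]
        split_ifs <;> norm_num
      simpa using add_nonneg (h i) (h j)
    | zero => simp
    | add x y _ _ hx hy =>
      intro i
      simpa using add_nonneg (hx i) (hy i)
    | smul r x _ hx =>
      intro i
      rw [NNReal.smul_def, map_smul]
      exact mul_nonneg r.2 (hx i)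
  · intro hx
    rw [← (Module.Basis.ofEquivFun (rayCoords n)).sum_equivFun x]
    refine Submodule.sum_mem _ fun i _ => ?_
    rw [Module.Basis.equivFun_ofEquivFun, Module.Basis.coe_ofEquivFun]
    beta_reduce
    rw [rayCoords_symm_single]
    exact Submodule.smul_mem _ (⟨_, hx i⟩ : ℝ≥0) (Submodule.subset_span ⟨i, i, le_rfl, rfl⟩)

/-- for `0 ≤ k ≤ n`, the number of nonempty exposed faces of `K(𝒮)`
(sets of the form `F = {x ∈ K : ∀ y ∈ K, ℓ(y) ≤ ℓ(x)}` for a linear functional `ℓ`)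
whose linear span has dimension `k` is exactly `C(n,k)`. -/
theorem count_faces (n : ℕ) [NeZero n] (hn : 2 ≤ n) (k : ℕ) (hk : k ≤ n) :
    {F : Set (Fin n → ℝ) | F.Nonempty ∧
        (∃ ℓ : (Fin n → ℝ) →ₗ[ℝ] ℝ,
          F = {x ∈ coneK n | ∀ y ∈ coneK n, ℓ y ≤ ℓ x}) ∧
        Module.finrank ℝ ↥(Submodule.span ℝ F) = k}.ncard = n.choose k := by
  have h := ncard_exposed_faces_finrank (Module.Basis.ofEquivFun (rayCoords n))
    (K := coneK n) (fun x => mem_coneK_iff n x) k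
  rwa [Fintype.card_fin] at h

end
end

section
/- Let k ≥ 2. In ℤ^{k+1}, let 𝒜²_k = {e₁ + 2e_j : 2 ≤ j ≤ k+1} ∪ {e₁ + e_i + e_j : 2 ≤ i < j ≤ k+1} and let β = {e₁ + e₂ + e_j : 2 ≤ j ≤ k+1}. Then the subgroup of ℤ^{k+1} generated by 𝒜²_k equals the subgroup generated by β, and β is a linearly independent set of k vectors; in particular, the ℤ-span of 𝒜²_k is a free abelian group of rank k. -/
noncomputable section

/-- The set `𝒜²_k = {e₁ + 2e_j : 2 ≤ j ≤ k+1} ∪ {e₁ + e_i + e_j : 2 ≤ i < j ≤ k+1}`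
in `ℤ^{k+1}` (Lean index `t : Fin (k+1)` corresponds to the paper index `t+1`;
the case `i = j` gives `e₁ + 2e_i`). -/
def A2set (k : ℕ) : Set (Fin (k + 1) → ℤ) :=
  {v | ∃ i j : Fin (k + 1), i ≠ 0 ∧ j ≠ 0 ∧ i ≤ j ∧
    v = fun t => (if t = 0 then 1 else 0) + (if t = i then 1 else 0) +
      (if t = j then 1 else 0)}

/-- The family `β = {e₁ + e₂ + e_j : 2 ≤ j ≤ k+1}` of `k` vectors in `ℤ^{k+1}`
(the index `j : Fin k` corresponds to the paper index `j+2`, via `j.succ`). -/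
def betaFam (k : ℕ) (j : Fin k) : Fin (k + 1) → ℤ :=
  fun t => (if t = 0 then 1 else 0) + (if t = 1 then 1 else 0) +
    (if t = j.succ then 1 else 0)

/-- The sum `e₁ + e_i + e_j` is an integer combination of three vectors of `β`. -/
theorem pairSum_eq_betaFam (k : ℕ) (i j o : Fin k) (ho : o.succ = 1) :
    (fun t : Fin (k + 1) => (if t = 0 then 1 else 0) + (if t = i.succ then 1 else 0) +
      (if t = j.succ then 1 else 0) : Fin (k + 1) → ℤ) =
      betaFam k i + betaFam k j - betaFam k o := by
  funext t
  simp only [betaFam, Pi.add_apply, Pi.sub_apply, ho]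
  ring

theorem exists_fin_succ_eq_one {k : ℕ} (hk : 1 ≤ k) : ∃ o : Fin k, o.succ = 1 := by
  obtain ⟨n, rfl⟩ := Nat.exists_eq_add_of_le' hk
  exact ⟨0, rfl⟩

theorem betaFam_mem_A2set {k : ℕ} (j : Fin k) : betaFam k j ∈ A2set k := by
  obtain ⟨n, rfl⟩ := Nat.exists_eq_add_of_le' (Nat.one_le_of_lt j.isLt)
  refine ⟨1, j.succ, one_ne_zero, Fin.succ_ne_zero j, ?_, rfl⟩
  exact Fin.succ_le_succ_iff.mpr (Fin.zero_le j)

theorem span_A2set_eq {k : ℕ} (hk : 1 ≤ k) :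
    Submodule.span ℤ (A2set k) = Submodule.span ℤ (Set.range (betaFam k)) := by
  obtain ⟨o, ho⟩ := exists_fin_succ_eq_one hk
  have hmem (j : Fin k) : betaFam k j ∈ Submodule.span ℤ (Set.range (betaFam k)) :=
    Submodule.subset_span (Set.mem_range_self j)
  apply le_antisymm
  · rw [Submodule.span_le]
    rintro v ⟨i, j, hi, hj, -, rfl⟩
    obtain ⟨i, rfl⟩ := Fin.exists_succ_eq.mpr hi
    obtain ⟨j, rfl⟩ := Fin.exists_succ_eq.mpr hj
    rw [pairSum_eq_betaFam k i j o ho]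
    exact sub_mem (add_mem (hmem i) (hmem j)) (hmem o)
  · exact Submodule.span_mono (Set.range_subset_iff.mpr betaFam_mem_A2set)

theorem linearIndependent_betaFam {k : ℕ} (hk : 1 ≤ k) : LinearIndependent ℤ (betaFam k) := by
  obtain ⟨o, ho⟩ := exists_fin_succ_eq_one hk
  rw [Fintype.linearIndependent_iff]
  intro g hg m
  have h0 : ∑ j, g j = 0 := by
    simpa [betaFam, ← ho, (Fin.succ_ne_zero _).symm] using congrFun hg 0
  have hm := congrFun hg m.succ
  simpa [betaFam, mul_add, Finset.sum_add_distrib, ← Finset.sum_mul, h0] using hm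

/-- the subgroup of `ℤ^{k+1}` generated by `𝒜²_k` equals the subgroup
generated by `β`, and `β` is a linearly independent family of `k` vectors; in
particular the ℤ-span of `𝒜²_k` is free of rank `k`. -/
theorem span_A2_eq_span_beta (k : ℕ) (hk : 2 ≤ k) :
    Submodule.span ℤ (A2set k) = Submodule.span ℤ (Set.range (betaFam k)) ∧
      LinearIndependent ℤ (betaFam k) ∧
      Module.finrank ℤ ↥(Submodule.span ℤ (A2set k)) = k := by
  have hk1 : 1 ≤ k := by omega
  refine ⟨span_A2set_eq hk1, linearIndependent_betaFam hk1, ?_⟩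
  rw [span_A2set_eq hk1,
    Module.finrank_eq_card_basis (Module.Basis.span (linearIndependent_betaFam hk1)),
    Fintype.card_fin]

end
end

section
/- Let k ≥ 2 and let 𝒜²_k = {e₁ + e_i + e_j : 2 ≤ i ≤ j ≤ k+1} ⊆ ℤ^{k+1}. Then the additive submonoid of ℤ^{k+1} generated by 𝒜²_k is saturated with respect to its real cone: for every x ∈ ℤ^{k+1}, x lies in the additive submonoid generated by 𝒜²_k if and only if x, regarded as a vector of ℝ^{k+1}, is a finite nonnegative real linear combination of elements of 𝒜²_k. -/
open scoped NNReal

noncomputable section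

/-- The set `𝒜²_k` regarded inside `ℝ^{k+1}`. -/
def A2setR (k : ℕ) : Set (Fin (k + 1) → ℝ) :=
  {v | ∃ i j : Fin (k + 1), i ≠ 0 ∧ j ≠ 0 ∧ i ≤ j ∧
    v = fun t => (if t = 0 then 1 else 0) + (if t = i then 1 else 0) +
      (if t = j then 1 else 0)}

/-- A generator of `𝒜²_k` may be indexed by an unordered pair of nonzero positions. -/
theorem mem_A2set_of_succ {k : ℕ} (i j : Fin k) :
    (fun t => (if t = 0 then 1 else 0) + (if t = i.succ then 1 else 0) +
      (if t = j.succ then 1 else 0)) ∈ A2set k := by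
  rcases le_total i j with h | h
  · exact ⟨i.succ, j.succ, i.succ_ne_zero, j.succ_ne_zero, Fin.succ_le_succ_iff.2 h, rfl⟩
  · refine ⟨j.succ, i.succ, j.succ_ne_zero, i.succ_ne_zero, Fin.succ_le_succ_iff.2 h, ?_⟩
    funext t
    ring

/-- Integer points with nonnegative coordinates whose tail sums to twice the first coordinate
lie in the submonoid generated by `𝒜²_k`. -/
theorem mem_closure_A2set_of_sum_eq {k : ℕ} (n : ℕ) (x : Fin (k + 1) → ℤ) (hx0 : x 0 = n)
    (hx : ∀ j : Fin k, 0 ≤ x j.succ) (hsum : ∑ j : Fin k, x j.succ = 2 * x 0) :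
    x ∈ AddSubmonoid.closure (A2set k) := by
  induction n generalizing x with
  | zero =>
    have hzero : x = 0 := by
      rw [hx0, Nat.cast_zero, mul_zero, Finset.sum_eq_zero_iff_of_nonneg fun j _ => hx j] at hsum
      funext t
      induction t using Fin.cases with
      | zero => simpa using hx0
      | succ j => exact hsum j (Finset.mem_univ j)
    exact hzero ▸ zero_mem _
  | succ n ih =>
    push_cast at hx0
    obtain ⟨i, -, hi⟩ := Finset.exists_lt_of_sum_lt (s := Finset.univ) (f := fun _ : Fin k => (0 : ℤ))
      (g := fun j => x j.succ) (by simp only [Finset.sum_const_zero]; lia)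
    obtain ⟨j, -, hj⟩ := Finset.exists_lt_of_sum_lt (s := Finset.univ) (f := fun _ : Fin k => (0 : ℤ))
      (g := fun j => x j.succ - if j = i then 1 else 0) (by
        simp only [Finset.sum_const_zero, Finset.sum_sub_distrib, Finset.sum_ite_eq',
          Finset.mem_univ, if_true]
        lia)
    set g : Fin (k + 1) → ℤ := fun t => (if t = 0 then 1 else 0) + (if t = i.succ then 1 else 0) +
      (if t = j.succ then 1 else 0) with hg
    have hg0 : g 0 = 1 := by simp [hg, (Fin.succ_ne_zero _).symm]
    have hgs (l : Fin k) : g l.succ = (if l = i then 1 else 0) + if l = j then 1 else 0 := by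
      simp [hg]
    have hsub : x - g ∈ AddSubmonoid.closure (A2set k) := by
      refine ih _ (by simp [hx0, hg0]) (fun l => ?_) ?_
      · have hl := hx l
        simp only [Pi.sub_apply, hgs]
        by_cases hli : l = i <;> by_cases hlj : l = j <;> grind
      · simp only [Pi.sub_apply, hgs, hg0, Finset.sum_sub_distrib, Finset.sum_add_distrib,
          Finset.sum_ite_eq', Finset.mem_univ, if_true, hsum]
        ring
    have hmem : g ∈ AddSubmonoid.closure (A2set k) :=
      AddSubmonoid.subset_closure (mem_A2set_of_succ i j)
    exact sub_add_cancel x g ▸ add_mem hsub hmem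

/-- The linear constraints cutting out the real cone over `𝒜²_k`. -/
theorem nonneg_and_sum_eq_of_mem_span_A2setR {k : ℕ} {y : Fin (k + 1) → ℝ}
    (hy : y ∈ Submodule.span ℝ≥0 (A2setR k)) :
    (∀ t, 0 ≤ y t) ∧ ∑ j : Fin k, y j.succ = 2 * y 0 := by
  induction hy using Submodule.span_induction with
  | mem y hy =>
    obtain ⟨i, j, hi, hj, -, rfl⟩ := hy
    obtain ⟨i, rfl⟩ := Fin.exists_succ_eq.2 hi
    obtain ⟨j, rfl⟩ := Fin.exists_succ_eq.2 hj
    refine ⟨fun t => by positivity, ?_⟩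
    simp [Finset.sum_add_distrib, (Fin.succ_ne_zero _).symm]
    norm_num
  | zero => simp
  | add y z _ _ hy hz =>
    refine ⟨fun t => add_nonneg (hy.1 t) (hz.1 t), ?_⟩
    simp only [Pi.add_apply, Finset.sum_add_distrib, hy.2, hz.2]
    ring
  | smul c y _ hy =>
    refine ⟨fun t => mul_nonneg c.2 (hy.1 t), ?_⟩
    simp only [Pi.smul_apply, NNReal.smul_def, smul_eq_mul, ← Finset.mul_sum, hy.2]
    ring

/-- the additive submonoid of `ℤ^{k+1}` generated by `𝒜²_k` is
saturated: `x` belongs to it iff `x`, regarded in `ℝ^{k+1}`, is a finite nonnegative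
real combination of elements of `𝒜²_k`. -/
theorem A2set_saturated (k : ℕ) (hk : 2 ≤ k) (x : Fin (k + 1) → ℤ) :
    x ∈ AddSubmonoid.closure (A2set k) ↔
      (fun t => (x t : ℝ)) ∈ Submodule.span ℝ≥0 (A2setR k) := by
  constructor
  · intro hx
    induction hx using AddSubmonoid.closure_induction with
    | mem x hx =>
      obtain ⟨i, j, hi, hj, hij, rfl⟩ := hx
      refine Submodule.subset_span ⟨i, j, hi, hj, hij, ?_⟩
      funext t
      push_cast
      rfl
    | zero =>
      convert zero_mem (Submodule.span ℝ≥0 (A2setR k)) using 1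
      funext t
      simp
    | add x y _ _ hx hy =>
      convert add_mem hx hy using 1
      funext t
      simp
  · intro hx
    obtain ⟨hnonneg, hsum⟩ := nonneg_and_sum_eq_of_mem_span_A2setR hx
    have hx_nonneg (t) : 0 ≤ x t := by exact_mod_cast hnonneg t
    exact mem_closure_A2set_of_sum_eq (x 0).toNat x (Int.toNat_of_nonneg (hx_nonneg 0)).symm
      (fun j => hx_nonneg j.succ) (by exact_mod_cast hsum)

end
end
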